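/- For every odd integer r ≥ 3, γ(r) ≤ max{π(T̂_{2i}^{2i+1}) : 1 ≤ i ≤ ⌊r/2⌋}; that is, the maximum Turán density among all r-uniform hypergraphs with exactly three edges is at most the maximum, over 1 ≤ i ≤ ⌊r/2⌋, of the Turán densities of the (2i+1)-suspensions of the expanded triangles T_{2i}. -/

import Mathlib

open Filter

/-- The degree of a vertex in a hypergraph given as a finite set of edges. -/
def hypDegree {V : Type*} [DecidableEq V] (F : Finset (Finset V)) (v : V) : ℕ :=
  (F.filter fun e => v ∈ e).card

/-- `H` contains a copy of `F`: a map injective on the vertex support of `F`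
sending every edge of `F` to an edge of `H`. -/
def HasCopy {V W : Type*} [DecidableEq V] (H : Finset (Finset V))
    (F : Finset (Finset W)) : Prop :=
  ∃ φ : W → V, Set.InjOn φ (⋃ e ∈ F, (e : Set W)) ∧ ∀ e ∈ F, e.image φ ∈ H

/-- `F` is isomorphic to `G` (as edge sets; isolated vertices are irrelevant). -/
def IsIsoTo {V W : Type*} [DecidableEq V] (F : Finset (Finset W))
    (G : Finset (Finset V)) : Prop :=
  ∃ φ : W → V, Set.InjOn φ (⋃ e ∈ F, (e : Set W)) ∧ F.image (fun e => e.image φ) = G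

open scoped Classical in
/-- The Turán number `ex(n, F)`: the maximum number of edges of an `F`-free
`r`-uniform hypergraph on `n` vertices. -/
noncomputable def exNum (r n : ℕ) {m : ℕ} (F : Finset (Finset (Fin m))) : ℕ :=
  ((Finset.univ : Finset (Finset (Finset (Fin n)))).filter fun H =>
    (∀ e ∈ H, e.card = r) ∧ ¬ HasCopy H F).sup Finset.card

/-- The Turán density `π(F) = lim_{n → ∞} ex(n,F) / C(n,r)` (the limit exists). -/
noncomputable def turanDensity (r : ℕ) {m : ℕ} (F : Finset (Finset (Fin m))) : ℝ :=
  limUnder atTop fun n : ℕ => (exNum r n F : ℝ) / (n.choose r : ℝ)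

/-- `γ(r)`: the maximum Turán density of an `r`-uniform hypergraph with exactly
three edges. -/
noncomputable def gammaT (r : ℕ) : ℝ :=
  sSup {x : ℝ | ∃ (m : ℕ) (F : Finset (Finset (Fin m))),
    (∀ e ∈ F, e.card = r) ∧ F.card = 3 ∧ turanDensity r F = x}

/-- The expanded triangle `T_{2k}` on `3k` vertices: three pairwise disjoint
`k`-sets `S 0, S 1, S 2`, with edges `S 0 ∪ S 1`, `S 1 ∪ S 2`, `S 2 ∪ S 0`. -/
def expTriangle (k : ℕ) : Finset (Finset (Fin (3 * k))) :=
  let S : ℕ → Finset (Fin (3 * k)) :=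
    fun a => Finset.univ.filter fun v => a * k ≤ v.val ∧ v.val < (a + 1) * k
  {S 0 ∪ S 1, S 1 ∪ S 2, S 2 ∪ S 0}

/-- The suspension of a hypergraph: add the same set of `t` new cone vertices
to every edge.  For an `s`-graph `F`, the `r`-suspension `F̂^r` is `suspend (r - s) F`. -/
def suspend {m : ℕ} (t : ℕ) (F : Finset (Finset (Fin m))) :
    Finset (Finset (Fin (m + t))) :=
  F.image fun e =>
    e.image (Fin.castAdd t) ∪ Finset.univ.filter fun v : Fin (m + t) => m ≤ v.val


/-! ### Counting embeddings -/

lemma aux_emb_count {α V : Type*} [Fintype α] [DecidableEq α] [Fintype V] [DecidableEq V]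
    (r : ℕ) (e : Finset α) (he : e.card = r) (H : Finset (Finset V))
    (hH : ∀ f ∈ H, f.card = r) :
    (Finset.univ.filter fun φ : α ↪ V => e.image φ ∈ H).card * (Fintype.card V).choose r
      = H.card * Fintype.card (α ↪ V) := by
  classical
  rcases H.eq_empty_or_nonempty with rfl | ⟨f0, hf0⟩
  · simp
  set N : Finset V → ℕ := fun f => (Finset.univ.filter fun φ : α ↪ V => e.image φ = f).card with hN
  have key : ∀ f f' : Finset V, f.card = r → f'.card = r → N f ≤ N f' := by
    intro f f' hf hf'
    have hc : Fintype.card {x // x ∈ f} = Fintype.card {x // x ∈ f'} := by simp [hf, hf']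
    let σ : Equiv.Perm V := (Fintype.equivOfCardEq hc).extendSubtype
    have hσ : f.image σ = f' := by
      apply Finset.eq_of_subset_of_card_le
      · intro y hy
        obtain ⟨x, hx, rfl⟩ := Finset.mem_image.1 hy
        exact (Fintype.equivOfCardEq hc).extendSubtype_mem x hx
      · rw [Finset.card_image_of_injective _ σ.injective, hf, hf']
    apply Finset.card_le_card_of_injOn (fun φ => φ.trans σ.toEmbedding)
    · intro φ hφ
      simp only [Finset.coe_filter, Finset.mem_univ, true_and, Set.mem_ofPred_eq] at hφ ⊢
      rw [← hσ, ← hφ, Finset.image_image]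
      rfl
    · intro φ _ φ' _ h
      ext x
      have := DFunLike.congr_fun h x
      simpa using this
  have key' : ∀ f : Finset V, f.card = r → N f = N f0 := fun f hf =>
    le_antisymm (key _ _ hf (hH _ hf0)) (key _ _ (hH _ hf0) hf)
  have h1 : (Finset.univ.filter fun φ : α ↪ V => e.image φ ∈ H).card = H.card * N f0 := by
    rw [Finset.card_eq_sum_card_fiberwise (f := fun φ : α ↪ V => e.image φ) (t := H)
      (by intro φ hφ; simpa using hφ)]
    rw [Finset.sum_congr rfl (g := fun _ => N f0)]
    · simp
    · intro f hf
      rw [← key' f (hH f hf), hN]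
      simp only
      congr 1
      ext φ
      simp only [Finset.mem_filter, Finset.mem_univ, true_and]
      constructor
      · exact fun h => h.2
      · intro h
        exact ⟨h ▸ hf, h⟩
  have h2 : Fintype.card (α ↪ V) = (Fintype.card V).choose r * N f0 := by
    rw [← Finset.card_univ, Finset.card_eq_sum_card_fiberwise (f := fun φ : α ↪ V => e.image φ)
      (t := Finset.powersetCard r Finset.univ)
      (by
        intro φ _
        simp [Finset.card_image_of_injective _ φ.injective, he])]
    rw [Finset.sum_congr rfl (g := fun _ => N f0)]
    · simp
    · intro f hf
      rw [← key' f (Finset.mem_powersetCard.1 hf).2]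
  rw [h1, h2]
  ring

lemma aux_avg {α V ι : Type*} [Fintype α] [DecidableEq α] [Fintype V] [DecidableEq V]
    (r : ℕ) (I : Finset ι) (E : ι → Finset α) (hE : ∀ i ∈ I, (E i).card = r)
    (H : Finset (Finset V)) (hH : ∀ f ∈ H, f.card = r) :
    (∑ φ : α ↪ V, (I.filter fun i => (E i).image φ ∈ H).card) * (Fintype.card V).choose r
      = I.card * (H.card * Fintype.card (α ↪ V)) := by
  classical
  have : (∑ φ : α ↪ V, (I.filter fun i => (E i).image φ ∈ H).card)
      = ∑ i ∈ I, (Finset.univ.filter fun φ : α ↪ V => (E i).image φ ∈ H).card := by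
    simp only [Finset.card_filter]
    exact Finset.sum_comm
  rw [this, Finset.sum_mul, Finset.sum_congr rfl
    (fun i hi => aux_emb_count r (E i) (hE i hi) H hH)]
  simp

/-! ### The box lemma -/

lemma aux_box (m : ℕ) : ∀ (h : ℕ) (δ : ℝ), 0 < δ → ∃ N0 : ℕ, ∀ n : ℕ, N0 ≤ n →
    ∀ S : Finset (Fin m → Fin n), δ * (n : ℝ) ^ m ≤ S.card →
    ∃ Φ : Fin m → Fin h → Fin n, (∀ w, Function.Injective (Φ w)) ∧
      ∀ c : Fin m → Fin h, (fun w => Φ w (c w)) ∈ S := by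
  classical
  induction m with
  | zero =>
    intro h δ hδ
    refine ⟨0, fun n _ S hS => ⟨fun w => w.elim0, fun w => w.elim0, fun c => ?_⟩⟩
    have : (0 : ℝ) < S.card := lt_of_lt_of_le (by simpa using hδ) hS
    have : 0 < S.card := by exact_mod_cast this
    obtain ⟨x, hx⟩ := Finset.card_pos.1 this
    convert hx using 1
  | succ m ih =>
    intro h δ hδ
    obtain ⟨N1, hN1⟩ := ih h ((δ / 2) * (δ / 4) ^ h / 2) (by positivity)
    obtain ⟨N2, hN2⟩ := exists_nat_ge (4 * h / δ)
    refine ⟨max N1 (N2 + 1), fun n hn S hS => ?_⟩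
    have hn1 : N1 ≤ n := le_trans (le_max_left _ _) hn
    have hn2 : N2 + 1 ≤ n := le_trans (le_max_right _ _) hn
    have hn0 : (0 : ℝ) < n := by exact_mod_cast (by omega : 0 < n)
    have hnh : (h : ℝ) ≤ δ / 4 * n := by
      have : (N2 : ℝ) ≤ n := by exact_mod_cast (by omega : N2 ≤ n)
      have h3 : 4 * h / δ ≤ (n : ℝ) := hN2.trans this
      rw [div_le_iff₀ hδ] at h3
      linarith
    set D : (Fin m → Fin n) → Finset (Fin n) :=
      fun y => Finset.univ.filter fun x => (Fin.cons x y : Fin (m + 1) → Fin n) ∈ S with hD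
    have hSsum : S.card = ∑ y : Fin m → Fin n, (D y).card := by
      rw [Finset.card_eq_sum_card_fiberwise (f := fun z : Fin (m + 1) → Fin n => Fin.tail z)
        (t := Finset.univ) (by intro _ _; simp)]
      apply Finset.sum_congr rfl
      intro y _
      apply Finset.card_bij (fun z _ => z 0)
      · intro z hz
        simp only [Finset.mem_filter] at hz
        simp only [hD, Finset.mem_filter, Finset.mem_univ, true_and]
        rw [← hz.2, Fin.cons_self_tail]
        exact hz.1
      · intro z hz z' hz' h0
        simp only [Finset.mem_filter] at hz hz'
        rw [← Fin.cons_self_tail z, ← Fin.cons_self_tail z', hz.2, hz'.2, h0]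
      · intro x hx
        simp only [hD, Finset.mem_filter, Finset.mem_univ, true_and] at hx
        exact ⟨Fin.cons x y, by simp [hx], by simp⟩
    set Y : Finset (Fin m → Fin n) :=
      Finset.univ.filter fun y => δ / 2 * n ≤ ((D y).card : ℝ) with hY
    have hYcard : δ / 2 * (n : ℝ) ^ m ≤ Y.card := by
      have h1 : (S.card : ℝ) ≤ Y.card * n + (n : ℝ) ^ m * (δ / 2 * n) := by
        rw [hSsum]
        push_cast
        rw [← Finset.sum_filter_add_sum_filter_not Finset.univ
          (fun y => δ / 2 * n ≤ ((D y).card : ℝ))]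
        apply add_le_add
        · calc _ ≤ ∑ y ∈ Y, (n : ℝ) := by
                apply Finset.sum_le_sum
                intro y _
                have := Finset.card_le_univ (D y)
                simp only [Fintype.card_fin] at this
                exact_mod_cast this
            _ = _ := by simp
        · calc _ ≤ ∑ y ∈ Finset.univ.filter (fun y => ¬ δ / 2 * n ≤ ((D y).card : ℝ)),
                  (δ / 2 * n) := by
                apply Finset.sum_le_sum
                intro y hy
                simp only [Finset.mem_filter, not_le] at hy
                exact hy.2.le
            _ ≤ ∑ y : Fin m → Fin n, (δ / 2 * n) := by
                apply Finset.sum_le_sum_of_subset_of_nonneg (Finset.filter_subset _ _)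
                intros
                positivity
            _ = _ := by simp
      rw [pow_succ] at hS
      have h2 : (δ / 2 * (n : ℝ) ^ m) * n ≤ Y.card * n := by nlinarith
      exact le_of_mul_le_mul_right h2 hn0
    set T : (Fin h ↪ Fin n) → Finset (Fin m → Fin n) :=
      fun x => Finset.univ.filter fun y => ∀ j, (Fin.cons (x j) y : Fin (m + 1) → Fin n) ∈ S
      with hT
    have hTsum : (Y.card : ℝ) * (δ / 4 * n) ^ h ≤ ∑ x : Fin h ↪ Fin n, ((T x).card : ℝ) := by
      have e1 : (∑ x : Fin h ↪ Fin n, ((T x).card : ℝ)) = ∑ y : Fin m → Fin n,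
          ((Finset.univ.filter fun x : Fin h ↪ Fin n =>
            ∀ j, (Fin.cons (x j) y : Fin (m + 1) → Fin n) ∈ S).card : ℝ) := by
        simp only [hT, Finset.card_filter]
        push_cast
        exact Finset.sum_comm
      rw [e1]
      calc _ = ∑ y ∈ Y, (δ / 4 * (n : ℝ)) ^ h := by simp
        _ ≤ ∑ y ∈ Y, ((Finset.univ.filter fun x : Fin h ↪ Fin n =>
            ∀ j, (Fin.cons (x j) y : Fin (m + 1) → Fin n) ∈ S).card : ℝ) := by
            apply Finset.sum_le_sum
            intro y hy
            have hy : δ / 2 * n ≤ ((D y).card : ℝ) := (Finset.mem_filter.1 hy).2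
            have hle : (D y).card.descFactorial h ≤ (Finset.univ.filter fun x : Fin h ↪ Fin n =>
                ∀ j, (Fin.cons (x j) y : Fin (m + 1) → Fin n) ∈ S).card := by
              have : Fintype.card (Fin h ↪ {x // x ∈ D y}) = (D y).card.descFactorial h := by
                simp [Fintype.card_embedding_eq]
              rw [← this, ← Finset.card_univ]
              apply Finset.card_le_card_of_injOn
                (fun x => x.trans (Function.Embedding.subtype _))
              · intro x _
                simp only [Finset.coe_filter, Finset.mem_univ, true_and, Set.mem_ofPred_eq]
                intro j
                exact (Finset.mem_filter.1 (x j).2).2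
              · intro x _ x' _ hxx
                ext j
                have := DFunLike.congr_fun hxx j
                have h5 : x j = x' j := by simpa using this
                rw [h5]
            have hp := (Nat.pow_sub_le_descFactorial (D y).card h).trans hle
            have hp' : (((D y).card + 1 - h : ℕ) : ℝ) ^ h ≤ ((Finset.univ.filter
                fun x : Fin h ↪ Fin n =>
                ∀ j, (Fin.cons (x j) y : Fin (m + 1) → Fin n) ∈ S).card : ℝ) := by
              exact_mod_cast hp
            refine le_trans (pow_le_pow_left₀ (by positivity) ?_ h) hp'
            have : ((D y).card : ℝ) + 1 ≤ ((D y).card + 1 - h : ℕ) + h := by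
              exact_mod_cast (by omega : (D y).card + 1 ≤ ((D y).card + 1 - h) + h)
            linarith
        _ ≤ _ := by
            apply Finset.sum_le_sum_of_subset_of_nonneg (Finset.subset_univ _)
            intros
            positivity
    have hex : ∃ x : Fin h ↪ Fin n, (δ / 2) * (δ / 4) ^ h / 2 * (n : ℝ) ^ m ≤ (T x).card := by
      by_contra hcon
      push Not at hcon
      have hc : (Fintype.card (Fin h ↪ Fin n) : ℝ) ≤ (n : ℝ) ^ h := by
        rw [Fintype.card_embedding_eq]
        have := Nat.descFactorial_le_pow n h
        simp only [Fintype.card_fin]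
        exact_mod_cast this
      have h1 : ∑ x : Fin h ↪ Fin n, ((T x).card : ℝ)
          ≤ (n : ℝ) ^ h * ((δ / 2) * (δ / 4) ^ h / 2 * (n : ℝ) ^ m) := by
        calc _ ≤ ∑ x : Fin h ↪ Fin n, ((δ / 2) * (δ / 4) ^ h / 2 * (n : ℝ) ^ m) :=
              Finset.sum_le_sum fun x _ => (hcon x).le
          _ = (Fintype.card (Fin h ↪ Fin n) : ℝ) * ((δ / 2) * (δ / 4) ^ h / 2 * (n : ℝ) ^ m) := by
              simp
          _ ≤ _ := by gcongr
      have h2 : δ / 2 * (n : ℝ) ^ m * (δ / 4 * n) ^ h ≤ (Y.card : ℝ) * (δ / 4 * n) ^ h := by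
        gcongr
      have h3 : 0 < (δ / 2) * (δ / 4) ^ h * (n : ℝ) ^ m * (n : ℝ) ^ h := by positivity
      have h4 := (h2.trans hTsum).trans h1
      rw [mul_pow] at h4
      nlinarith
    obtain ⟨x, hx⟩ := hex
    obtain ⟨Φ, hΦ1, hΦ2⟩ := hN1 n hn1 (T x) hx
    refine ⟨Fin.cons (fun j => x j) Φ, ?_, ?_⟩
    · intro w
      refine Fin.cases ?_ (fun w => ?_) w
      · simpa using x.injective
      · simpa using hΦ1 w
    · intro c
      have := (Finset.mem_filter.1 (hΦ2 (Fin.tail c))).2 (c 0)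
      convert this using 1
      funext w
      refine Fin.cases ?_ (fun w => ?_) w
      · simp
      · simp [Fin.tail]

/-! ### Turán numbers and densities -/

lemma aux_ex_ge (r n : ℕ) {m : ℕ} (F : Finset (Finset (Fin m))) (H : Finset (Finset (Fin n)))
    (hH : ∀ e ∈ H, e.card = r) (hF : ¬ HasCopy H F) : H.card ≤ exNum r n F := by
  classical
  unfold exNum
  apply Finset.le_sup (f := Finset.card)
  simp only [Finset.mem_filter, Finset.mem_univ, true_and]
  exact ⟨hH, hF⟩

lemma aux_ex_attained (r n : ℕ) {m : ℕ} (F : Finset (Finset (Fin m))) (h0 : 0 < exNum r n F) :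
    ∃ H : Finset (Finset (Fin n)), (∀ e ∈ H, e.card = r) ∧ ¬ HasCopy H F ∧
      H.card = exNum r n F := by
  classical
  unfold exNum at h0 ⊢
  set A := ((Finset.univ : Finset (Finset (Finset (Fin n)))).filter fun H =>
    (∀ e ∈ H, e.card = r) ∧ ¬ HasCopy H F) with hA
  have hne : A.Nonempty := by
    rw [Finset.nonempty_iff_ne_empty]
    intro h
    rw [h] at h0
    simp at h0
  obtain ⟨H, hH, he⟩ := Finset.exists_mem_eq_sup A hne Finset.card
  have := (Finset.mem_filter.1 hH).2
  exact ⟨H, this.1, this.2, he.symm⟩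

lemma aux_mono (r : ℕ) {m : ℕ} (F : Finset (Finset (Fin m))) (M n : ℕ) (hr : r ≤ M)
    (hM : M ≤ n) :
    (exNum r n F : ℝ) / (n.choose r : ℝ) ≤ (exNum r M F : ℝ) / (M.choose r : ℝ) := by
  classical
  have c1 : (0 : ℝ) < n.choose r := by exact_mod_cast Nat.choose_pos (hr.trans hM)
  have c2 : (0 : ℝ) < M.choose r := by exact_mod_cast Nat.choose_pos hr
  rw [div_le_div_iff₀ c1 c2]
  rcases Nat.eq_zero_or_pos (exNum r n F) with h0 | h0
  · rw [h0]; simp; positivity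
  obtain ⟨H, hH, hF, hc⟩ := aux_ex_attained r n F h0
  have hav := aux_avg (α := Fin M) (V := Fin n) r
    (Finset.powersetCard r (Finset.univ : Finset (Fin M))) id
    (fun e he => (Finset.mem_powersetCard.1 he).2) H hH
  simp only [id, Fintype.card_fin, Finset.card_powersetCard, Finset.card_univ] at hav
  have hle : (∑ φ : Fin M ↪ Fin n, ((Finset.powersetCard r (Finset.univ : Finset (Fin M))).filter
      fun e => e.image φ ∈ H).card) ≤ Fintype.card (Fin M ↪ Fin n) * exNum r M F := by
    calc _ ≤ ∑ φ : Fin M ↪ Fin n, exNum r M F := by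
          apply Finset.sum_le_sum
          intro φ _
          apply aux_ex_ge
          · intro e he
            exact (Finset.mem_powersetCard.1 (Finset.mem_filter.1 he).1).2
          · rintro ⟨g, hg1, hg2⟩
            refine hF ⟨φ ∘ g, φ.injective.comp_injOn hg1, fun e he => ?_⟩
            have := (Finset.mem_filter.1 (hg2 e he)).2
            rwa [Finset.image_image] at this
      _ = _ := by simp
  have hpos : 0 < Fintype.card (Fin M ↪ Fin n) := by
    rw [Fintype.card_embedding_eq]
    simpa [Nat.pos_iff_ne_zero] using hM
  have h3 : Fintype.card (Fin M ↪ Fin n) * (exNum r n F * M.choose r)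
      ≤ Fintype.card (Fin M ↪ Fin n) * (exNum r M F * n.choose r) := by
    calc _ = M.choose r * (H.card * Fintype.card (Fin M ↪ Fin n)) := by rw [hc]; ring
      _ = _ := hav.symm
      _ ≤ Fintype.card (Fin M ↪ Fin n) * exNum r M F * n.choose r :=
          Nat.mul_le_mul_right _ hle
      _ = _ := by ring
  exact_mod_cast Nat.le_of_mul_le_mul_left h3 hpos

lemma aux_tendsto (r : ℕ) {m : ℕ} (F : Finset (Finset (Fin m))) :
    Tendsto (fun n : ℕ => (exNum r n F : ℝ) / (n.choose r : ℝ)) atTop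
      (nhds (turanDensity r F)) := by
  have h1 : Antitone fun n : ℕ => (exNum r (n + r) F : ℝ) / ((n + r).choose r : ℝ) :=
    fun a b hab => aux_mono r F (a + r) (b + r) (by omega) (by omega)
  have h2 : BddBelow (Set.range fun n : ℕ => (exNum r (n + r) F : ℝ) / ((n + r).choose r : ℝ)) :=
    ⟨0, by rintro _ ⟨n, rfl⟩; positivity⟩
  have h3 := tendsto_atTop_ciInf h1 h2
  have h4 := (tendsto_add_atTop_iff_nat
    (f := fun n : ℕ => (exNum r n F : ℝ) / (n.choose r : ℝ)) r).1 h3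
  exact tendsto_nhds_limUnder ⟨_, h4⟩

lemma aux_nonneg (r : ℕ) {m : ℕ} (F : Finset (Finset (Fin m))) : 0 ≤ turanDensity r F :=
  ge_of_tendsto' (aux_tendsto r F) fun n => by positivity

lemma aux_le (r : ℕ) {m : ℕ} (F : Finset (Finset (Fin m))) (n : ℕ) (hn : r ≤ n) :
    turanDensity r F ≤ (exNum r n F : ℝ) / (n.choose r : ℝ) := by
  apply le_of_tendsto (aux_tendsto r F)
  filter_upwards [eventually_ge_atTop n] with k hk
  exact aux_mono r F n k hn hk

set_option maxHeartbeats 1000000 in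
lemma aux_dens_le (s t : ℕ) {mF mG : ℕ} (F : Finset (Finset (Fin mF)))
    (G : Finset (Finset (Fin mG))) (hF : ∀ e ∈ F, e.card = s + t)
    (ψ : Fin mF → Fin mG ⊕ Fin t)
    (hψ : ∀ e ∈ F, ∃ e' ∈ G, e.image ψ = e'.disjSum Finset.univ) :
    turanDensity (s + t) F ≤ turanDensity s G := by
  classical
  by_contra hcon
  push Not at hcon
  set p := turanDensity s G with hp
  obtain ⟨ε, hε, hε2⟩ : ∃ ε : ℝ, 0 < ε ∧ turanDensity (s + t) F = p + 2 * ε :=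
    ⟨(turanDensity (s + t) F - p) / 2, by linarith, by ring⟩
  have hp0 : 0 ≤ p := aux_nonneg s G
  obtain ⟨M', hM'1, hM's⟩ := (((aux_tendsto s G).eventually_lt_const
    (show turanDensity s G < p + ε by linarith)).and (eventually_ge_atTop s)).exists
  set x := exNum s M' G with hx
  set K := M'.choose s with hK
  have hK0 : (0 : ℝ) < K := by exact_mod_cast Nat.choose_pos hM's
  rw [div_lt_iff₀ hK0] at hM'1
  set M := M' + t with hM
  set J := Fintype.card (Fin mG → Fin M') with hJ
  obtain ⟨N0, hN0⟩ := aux_box M mF (ε / (J + 1) * (1 / 2) ^ M) (by positivity)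
  obtain ⟨n, hn⟩ : ∃ n, n = N0 + 2 * M + s + t := ⟨_, rfl⟩
  have hex := aux_le (s + t) F n (by omega)
  have hC : (0 : ℝ) < n.choose (s + t) := by
    exact_mod_cast Nat.choose_pos (by omega : s + t ≤ n)
  rw [le_div_iff₀ hC, hε2] at hex
  have hex0 : 0 < exNum (s + t) n F := by
    have : (0 : ℝ) < exNum (s + t) n F := lt_of_lt_of_le (by positivity) hex
    exact_mod_cast this
  obtain ⟨H, hH, hfree, hHc⟩ := aux_ex_attained _ _ _ hex0
  rw [← hHc] at hex
  set L : ((Fin M' ⊕ Fin t) ↪ Fin n) → Finset (Finset (Fin M')) := fun φ =>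
    (Finset.powersetCard s (Finset.univ : Finset (Fin M'))).filter fun e =>
      (e.disjSum (Finset.univ : Finset (Fin t))).image φ ∈ H with hL
  have hav := aux_avg (α := Fin M' ⊕ Fin t) (V := Fin n) (s + t)
    (Finset.powersetCard s (Finset.univ : Finset (Fin M')))
    (fun e => e.disjSum (Finset.univ : Finset (Fin t)))
    (fun e he => by simp [(Finset.mem_powersetCard.1 he).2]) H hH
  simp only [Fintype.card_fin, Finset.card_powersetCard, Finset.card_univ] at hav
  set Tot := Fintype.card ((Fin M' ⊕ Fin t) ↪ Fin n) with hTot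
  have hTotge : (1 / 2 : ℝ) ^ M * (n : ℝ) ^ M ≤ Tot := by
    have h1 : (n + 1 - M) ^ M ≤ Tot := by
      rw [hTot, Fintype.card_embedding_eq]
      simpa using Nat.pow_sub_le_descFactorial n M
    have h2 : (((n + 1 - M : ℕ) : ℝ)) ^ M ≤ Tot := by exact_mod_cast h1
    rw [← mul_pow]
    refine le_trans (pow_le_pow_left₀ (by positivity) ?_ M) h2
    have : (n : ℝ) ≤ 2 * ((n + 1 - M : ℕ) : ℝ) := by
      exact_mod_cast (by omega : n ≤ 2 * (n + 1 - M))
    linarith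
  have hn0 : (0 : ℝ) < n ∨ M = 0 := by
    rcases Nat.eq_zero_or_pos M with h | h
    · exact Or.inr h
    · left
      exact_mod_cast (by omega : 0 < n)
  have hTot0 : (0 : ℝ) < Tot := by
    refine lt_of_lt_of_le ?_ hTotge
    rcases hn0 with h | h
    · positivity
    · rw [h]; simp
  set Bad : Finset ((Fin M' ⊕ Fin t) ↪ Fin n) := Finset.univ.filter fun φ => x < (L φ).card
    with hBad
  have hsum1 : (K : ℝ) * ((p + 2 * ε) * Tot) ≤ ∑ φ, ((L φ).card : ℝ) := by
    have h1 : (∑ φ, ((L φ).card : ℝ)) * n.choose (s + t) = K * (H.card * Tot) := by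
      exact_mod_cast hav
    have h2 : (K : ℝ) * ((p + 2 * ε) * Tot) * n.choose (s + t)
        ≤ (∑ φ, ((L φ).card : ℝ)) * n.choose (s + t) := by
      rw [h1]
      calc _ = K * (((p + 2 * ε) * n.choose (s + t)) * Tot) := by ring
        _ ≤ _ := by gcongr
    exact le_of_mul_le_mul_right h2 hC
  have hsum2 : ∑ φ, ((L φ).card : ℝ) ≤ Bad.card * K + Tot * x := by
    rw [← Finset.sum_filter_add_sum_filter_not Finset.univ (fun φ => x < (L φ).card)]
    apply add_le_add
    · calc _ ≤ ∑ φ ∈ Bad, (K : ℝ) := by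
            apply Finset.sum_le_sum
            intro φ _
            have : (L φ).card ≤ K := by
              refine (Finset.card_filter_le _ _).trans ?_
              simp [hK]
            exact_mod_cast this
        _ = _ := by simp
    · calc _ ≤ ∑ φ ∈ Finset.univ.filter (fun φ => ¬ x < (L φ).card), (x : ℝ) := by
            apply Finset.sum_le_sum
            intro φ hφ
            have := (Finset.mem_filter.1 hφ).2
            exact_mod_cast not_lt.1 this
        _ ≤ ∑ φ : (Fin M' ⊕ Fin t) ↪ Fin n, (x : ℝ) := by
            apply Finset.sum_le_sum_of_subset_of_nonneg (Finset.filter_subset _ _)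
            intros
            positivity
        _ = _ := by simp [hTot]
  have hBadge : ε * Tot ≤ Bad.card := by
    have h1 : (Tot : ℝ) * x ≤ Tot * ((p + ε) * K) := by gcongr
    have h2 : (ε * Tot) * K ≤ Bad.card * K := by nlinarith
    exact le_of_mul_le_mul_right h2 hK0
  set B : (Fin mG → Fin M') → Finset ((Fin M' ⊕ Fin t) ↪ Fin n) := fun g =>
    Finset.univ.filter fun φ => ∀ e ∈ G,
      ((e.image g).disjSum (Finset.univ : Finset (Fin t))).image φ ∈ H with hB
  have hcover : Bad ⊆ Finset.univ.biUnion B := by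
    intro φ hφ
    have hφ : x < (L φ).card := (Finset.mem_filter.1 hφ).2
    have hcopy : HasCopy (L φ) G := by
      by_contra hno
      have := aux_ex_ge s M' G (L φ)
        (fun e he => (Finset.mem_powersetCard.1 (Finset.mem_filter.1 he).1).2) hno
      omega
    obtain ⟨g, _, hg⟩ := hcopy
    simp only [Finset.mem_biUnion, Finset.mem_univ, true_and]
    exact ⟨g, Finset.mem_filter.2 ⟨Finset.mem_univ _,
      fun e he => (Finset.mem_filter.1 (hg e he)).2⟩⟩
  have hpig : ∃ g, ε / (J + 1) * Tot ≤ (B g).card := by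
    by_contra hno
    push Not at hno
    have h1 : Bad.card ≤ ∑ g, (B g).card :=
      (Finset.card_le_card hcover).trans Finset.card_biUnion_le
    have h2 : (Bad.card : ℝ) ≤ ∑ g, ((B g).card : ℝ) := by exact_mod_cast h1
    have h3 : ∑ g, ((B g).card : ℝ) ≤ J * (ε / (J + 1) * Tot) := by
      calc _ ≤ ∑ g : Fin mG → Fin M', (ε / (J + 1) * Tot) :=
            Finset.sum_le_sum fun g _ => (hno g).le
        _ = _ := by rw [Finset.sum_const, Finset.card_univ, nsmul_eq_mul]
    have h4 : (J : ℝ) * (ε / (J + 1) * Tot) < ε * Tot := by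
      have : (J : ℝ) * (ε / (J + 1) * Tot) = ε * Tot * (J / (J + 1)) := by ring
      rw [this]
      have h5 : (J : ℝ) / (J + 1) < 1 := by
        rw [div_lt_one (by positivity)]; linarith
      have h6 : 0 < ε * Tot := by positivity
      nlinarith
    linarith
  obtain ⟨g, hg⟩ := hpig
  let κ : Fin M' ⊕ Fin t ≃ Fin M := finSumFinEquiv
  set S : Finset (Fin M → Fin n) := (B g).image fun φ w => φ (κ.symm w) with hS
  have hScard : S.card = (B g).card := by
    apply Finset.card_image_of_injective
    intro φ φ' h
    ext z
    have := congrFun h (κ z)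
    simp only [Equiv.symm_apply_apply] at this
    rw [this]
  obtain ⟨Φ, hΦ1, hΦ2⟩ := hN0 n (by omega) S (by
    rw [hScard]
    refine le_trans ?_ hg
    rw [mul_assoc]
    gcongr)
  have hΦ3 : ∀ c : Fin M → Fin mF, Function.Injective (fun w => Φ w (c w)) ∧ ∀ e ∈ G,
      ((e.image g).disjSum (Finset.univ : Finset (Fin t))).image
        (fun z => Φ (κ z) (c (κ z))) ∈ H := by
    intro c
    obtain ⟨φ, hφ, hφe⟩ := Finset.mem_image.1 (hΦ2 c)
    have hφ := (Finset.mem_filter.1 hφ).2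
    constructor
    · rw [← hφe]
      exact φ.injective.comp κ.symm.injective
    · intro e he
      have h1 : (fun z => Φ (κ z) (c (κ z))) = φ := by
        funext z
        have := congrFun hφe (κ z)
        simpa using this.symm
      rw [h1]
      exact hφ e he
  apply hfree
  let ψ' : Fin mF → Fin M := fun v => κ (Sum.map g id (ψ v))
  refine ⟨fun v => Φ (ψ' v) v, ?_, ?_⟩
  · apply Function.Injective.injOn
    intro v v' hvv
    simp only at hvv
    by_cases hw : ψ' v = ψ' v'
    · rw [hw] at hvv
      exact hΦ1 _ hvv
    · exfalso
      have := (hΦ3 (fun w => if w = ψ' v then v else v')).1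
      apply hw
      apply this
      simp only [if_true]
      rw [if_neg (Ne.symm hw)]
      exact hvv
  · intro e he
    obtain ⟨e', he', heq⟩ := hψ e he
    have himg : e.image (fun v => Sum.map g id (ψ v)) = (e'.image g).disjSum Finset.univ := by
      have : e.image (fun v => Sum.map g id (ψ v)) = (e.image ψ).image (Sum.map g id) := by
        rw [Finset.image_image]; rfl
      rw [this, heq]
      ext z
      rcases z with z | z <;> simp
    rcases e.eq_empty_or_nonempty with h0 | ⟨v0, hv0⟩
    · have hz : s + t = 0 := by rw [← hF e he, h0]; rfl
      have hHe : ∀ f ∈ H, f = ∅ := fun f hf => Finset.card_eq_zero.1 (by rw [hH f hf, hz])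
      have : 0 < H.card := by omega
      obtain ⟨f, hf⟩ := Finset.card_pos.1 this
      rw [h0, Finset.image_empty, ← hHe f hf]
      exact hf
    · have hinj : Set.InjOn ψ' e := by
        rw [← Finset.card_image_iff]
        apply le_antisymm Finset.card_image_le
        have h1 := hH _ ((hΦ3 (fun _ => v0)).2 e' he')
        rw [hF e he, ← h1, ← himg, Finset.image_image]
        have : e.image ((fun z => Φ (κ z) v0) ∘ fun v => Sum.map g id (ψ v))
          = (e.image ψ').image (fun w => Φ w v0) := by
          rw [Finset.image_image]; rfl
        rw [this]
        exact Finset.card_image_le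
      let c : Fin M → Fin mF := fun w =>
        if h : ∃ v ∈ e, ψ' v = w then h.choose else v0
      have hc : ∀ v ∈ e, c (ψ' v) = v := by
        intro v hv
        have h : ∃ u ∈ e, ψ' u = ψ' v := ⟨v, hv, rfl⟩
        simp only [c, dif_pos h]
        exact hinj h.choose_spec.1 hv h.choose_spec.2
      have h2 := (hΦ3 c).2 e' he'
      rw [← himg, Finset.image_image] at h2
      convert h2 using 1
      apply Finset.image_congr
      intro v hv
      simp only [Function.comp]
      rw [show κ (Sum.map g id (ψ v)) = ψ' v from rfl, hc v hv]

/-! ### Reducing a three-edge hypergraph -/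

lemma aux_merge {W : Type*} [DecidableEq W] (r : ℕ) : ∀ (N : ℕ) (A B C : Finset W),
    (A ∪ B ∪ C).card = N → A.card = r → B.card = r → C.card = r →
    ∃ f : W → W, (A.image f).card = r ∧ (B.image f).card = r ∧ (C.image f).card = r ∧
      A.image f ⊆ B.image f ∪ C.image f ∧ B.image f ⊆ C.image f ∪ A.image f ∧
      C.image f ⊆ A.image f ∪ B.image f := by
  intro N
  induction N using Nat.strong_induction_on with
  | _ N ih =>
  -- one merging step
  have step : ∀ A B C : Finset W, (A ∪ B ∪ C).card = N → A.card = r → B.card = r → C.card = r →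
      ¬ A ⊆ B ∪ C →
      ∃ f : W → W, (A.image f).card = r ∧ (B.image f).card = r ∧ (C.image f).card = r ∧
      A.image f ⊆ B.image f ∪ C.image f ∧ B.image f ⊆ C.image f ∪ A.image f ∧
      C.image f ⊆ A.image f ∪ B.image f := by
    intro A B C hN hA hB hC hn
    obtain ⟨a, haA, ha⟩ := Finset.not_subset.1 hn
    simp only [Finset.mem_union, not_or] at ha
    have hBA : ¬ B ⊆ A := fun h => ha.1 (by
      rw [Finset.eq_of_subset_of_card_le h (by omega)]; exact haA)
    obtain ⟨u, huB, huA⟩ := Finset.not_subset.1 hBA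
    let q : W → W := Function.update id a u
    have hau : a ≠ u := fun h => huA (h ▸ haA)
    have qa : q a = u := by simp [q]
    have qn : ∀ x, x ≠ a → q x = x := fun x hx => by simp [q, hx]
    have hqB : B.image q = B := by
      conv_rhs => rw [← Finset.image_id (s := B)]
      exact Finset.image_congr fun x hx => qn x fun h => ha.1 (h ▸ hx)
    have hqC : C.image q = C := by
      conv_rhs => rw [← Finset.image_id (s := C)]
      exact Finset.image_congr fun x hx => qn x fun h => ha.2 (h ▸ hx)
    have hqA : (A.image q).card = r := by
      rw [← hA, Finset.card_image_iff]
      intro x hx y hy hxy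
      by_cases h1 : x = a <;> by_cases h2 : y = a
      · rw [h1, h2]
      · rw [h1, qa, qn y h2] at hxy
        exact absurd (hxy ▸ hy) huA
      · rw [h2, qa, qn x h1] at hxy
        exact absurd (hxy ▸ hx) huA
      · rwa [qn x h1, qn y h2] at hxy
    have hlt : (A.image q ∪ B.image q ∪ C.image q).card < N := by
      rw [← hN]
      apply Finset.card_lt_card
      rw [Finset.ssubset_iff_of_subset]
      · refine ⟨a, by simp [haA], ?_⟩
        rw [hqB, hqC]
        simp only [Finset.mem_union, not_or]
        refine ⟨⟨?_, ha.1⟩, ha.2⟩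
        intro h
        obtain ⟨x, hx, hxa⟩ := Finset.mem_image.1 h
        by_cases h1 : x = a
        · rw [h1, qa] at hxa
          exact hau hxa.symm
        · rw [qn x h1] at hxa
          exact h1 hxa
      · rw [hqB, hqC]
        intro y hy
        simp only [Finset.mem_union] at hy ⊢
        rcases hy with (hy | hy) | hy
        · obtain ⟨x, hx, rfl⟩ := Finset.mem_image.1 hy
          by_cases h1 : x = a
          · rw [h1, qa]
            exact Or.inl (Or.inr huB)
          · rw [qn x h1]
            exact Or.inl (Or.inl hx)
        · exact Or.inl (Or.inr hy)
        · exact Or.inr hy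
    obtain ⟨f, hf⟩ := ih _ hlt (A.image q) (B.image q) (C.image q) rfl hqA
      (by rw [hqB, hB]) (by rw [hqC, hC])
    refine ⟨f ∘ q, ?_⟩
    simpa only [Finset.image_image] using hf
  intro A B C hN hA hB hC
  by_cases h1 : A ⊆ B ∪ C
  · by_cases h2 : B ⊆ C ∪ A
    · by_cases h3 : C ⊆ A ∪ B
      · exact ⟨id, by simpa using ⟨hA, hB, hC, h1, h2, h3⟩⟩
      · obtain ⟨f, c, a, b, h, h', h''⟩ := step C A B (by
          rw [← hN]; congr 1; ext; simp; tauto) hC hA hB h3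
        exact ⟨f, a, b, c, h', h'', h⟩
    · obtain ⟨f, b, c, a, h, h', h''⟩ := step B C A (by
        rw [← hN]; congr 1; ext; simp; tauto) hB hC hA h2
      exact ⟨f, a, b, c, h'', h, h'⟩
  · exact step A B C hN hA hB hC h1

lemma aux_exists_image {W X : Type*} [DecidableEq X] (P : Finset W) (Q : Finset X)
    [Nonempty X] (h : P.card = Q.card) : ∃ f : W → X, P.image f = Q := by
  classical
  let e : {x // x ∈ P} ≃ {x // x ∈ Q} := Fintype.equivOfCardEq (by simpa using h)
  refine ⟨fun w => if hw : w ∈ P then e ⟨w, hw⟩ else Classical.arbitrary X, ?_⟩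
  ext y
  simp only [Finset.mem_image]
  constructor
  · rintro ⟨x, hx, rfl⟩
    rw [dif_pos hx]
    exact (e ⟨x, hx⟩).2
  · intro hy
    refine ⟨e.symm ⟨y, hy⟩, (e.symm ⟨y, hy⟩).2, ?_⟩
    rw [dif_pos (e.symm ⟨y, hy⟩).2]
    simp

/-- The four pieces of a degree-one-free triple are mapped onto prescribed sets. -/
lemma aux_pieces {W X : Type*} [DecidableEq W] [DecidableEq X] [Nonempty X]
    (A B C : Finset W) (Q0 Q1 Q2 Q3 : Finset X)
    (h1 : A ⊆ B ∪ C) (h2 : B ⊆ C ∪ A) (h3 : C ⊆ A ∪ B)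
    (c0 : (A ∩ B ∩ C).card = Q0.card) (c1 : ((A ∩ B) \ C).card = Q1.card)
    (c2 : ((B ∩ C) \ A).card = Q2.card) (c3 : ((C ∩ A) \ B).card = Q3.card) :
    ∃ f : W → X, A.image f = Q3 ∪ Q1 ∪ Q0 ∧ B.image f = Q1 ∪ Q2 ∪ Q0 ∧
      C.image f = Q2 ∪ Q3 ∪ Q0 := by
  obtain ⟨f0, e0⟩ := aux_exists_image _ _ c0
  obtain ⟨f1, e1⟩ := aux_exists_image _ _ c1
  obtain ⟨f2, e2⟩ := aux_exists_image _ _ c2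
  obtain ⟨f3, e3⟩ := aux_exists_image _ _ c3
  let f : W → X := fun w => if w ∈ A then (if w ∈ B then (if w ∈ C then f0 w else f1 w) else f3 w)
    else f2 w
  have g0 : (A ∩ B ∩ C).image f = Q0 := by
    rw [← e0]
    apply Finset.image_congr
    intro w hw
    simp only [Finset.coe_inter, Set.mem_inter_iff, Finset.mem_coe] at hw
    simp [f, hw.1.1, hw.1.2, hw.2]
  have g1 : ((A ∩ B) \ C).image f = Q1 := by
    rw [← e1]
    apply Finset.image_congr
    intro w hw
    simp only [Finset.mem_coe, Finset.mem_sdiff, Finset.mem_inter] at hw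
    simp [f, hw.1.1, hw.1.2, hw.2]
  have g2 : ((B ∩ C) \ A).image f = Q2 := by
    rw [← e2]
    apply Finset.image_congr
    intro w hw
    simp only [Finset.mem_coe, Finset.mem_sdiff, Finset.mem_inter] at hw
    simp [f, hw.2]
  have g3 : ((C ∩ A) \ B).image f = Q3 := by
    rw [← e3]
    apply Finset.image_congr
    intro w hw
    simp only [Finset.mem_coe, Finset.mem_sdiff, Finset.mem_inter] at hw
    simp [f, hw.1.2, hw.2]
  refine ⟨f, ?_, ?_, ?_⟩
  · rw [← g0, ← g1, ← g3, ← Finset.image_union, ← Finset.image_union]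
    congr 1
    ext w
    have := @h1 w
    simp only [Finset.mem_union, Finset.mem_sdiff, Finset.mem_inter] at this ⊢
    tauto
  · rw [← g0, ← g1, ← g2, ← Finset.image_union, ← Finset.image_union]
    congr 1
    ext w
    have := @h2 w
    simp only [Finset.mem_union, Finset.mem_sdiff, Finset.mem_inter] at this ⊢
    tauto
  · rw [← g0, ← g2, ← g3, ← Finset.image_union, ← Finset.image_union]
    congr 1
    ext w
    have := @h3 w
    simp only [Finset.mem_union, Finset.mem_sdiff, Finset.mem_inter] at this ⊢
    tauto

lemma aux_cards {W : Type*} [DecidableEq W] (r : ℕ) (A B C : Finset W)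
    (hA : A.card = r) (hB : B.card = r) (hC : C.card = r)
    (h1 : A ⊆ B ∪ C) (h2 : B ⊆ C ∪ A) (h3 : C ⊆ A ∪ B) :
    ∃ k, (A ∩ B ∩ C).card + 2 * k = r ∧ ((A ∩ B) \ C).card = k ∧
      ((B ∩ C) \ A).card = k ∧ ((C ∩ A) \ B).card = k := by
  have eA : A.card = (A ∩ B ∩ C).card + ((A ∩ B) \ C).card + ((C ∩ A) \ B).card := by
    rw [← Finset.card_inter_add_card_sdiff A B, ← Finset.card_inter_add_card_sdiff (A ∩ B) C]
    congr 2
    ext w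
    have := @h1 w
    simp only [Finset.mem_union, Finset.mem_sdiff, Finset.mem_inter] at this ⊢
    tauto
  have eB : B.card = (A ∩ B ∩ C).card + ((B ∩ C) \ A).card + ((A ∩ B) \ C).card := by
    rw [← Finset.card_inter_add_card_sdiff B C, ← Finset.card_inter_add_card_sdiff (B ∩ C) A]
    congr 2
    · congr 1
      ext w
      simp only [Finset.mem_inter]
      tauto
    · ext w
      have := @h2 w
      simp only [Finset.mem_union, Finset.mem_sdiff, Finset.mem_inter] at this ⊢
      tauto
  have eC : C.card = (A ∩ B ∩ C).card + ((C ∩ A) \ B).card + ((B ∩ C) \ A).card := by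
    rw [← Finset.card_inter_add_card_sdiff C A, ← Finset.card_inter_add_card_sdiff (C ∩ A) B]
    congr 2
    · congr 1
      ext w
      simp only [Finset.mem_inter]
      tauto
    · ext w
      have := @h3 w
      simp only [Finset.mem_union, Finset.mem_sdiff, Finset.mem_inter] at this ⊢
      tauto
  exact ⟨((A ∩ B) \ C).card, by omega, rfl, by omega, by omega⟩

/-- The part `S a`, embedded in the target of the final map. -/
def auxPart (k t a : ℕ) : Finset (Fin (3 * k + 1) ⊕ Fin t) :=
  Finset.univ.filter fun z => ∃ v : Fin (3 * k + 1), z = Sum.inl v ∧ a * k ≤ v.val ∧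
    v.val < (a + 1) * k

/-- The common part of all three edges. -/
def auxCore (k t : ℕ) : Finset (Fin (3 * k + 1) ⊕ Fin t) :=
  ({Fin.last (3 * k)} : Finset (Fin (3 * k + 1))).disjSum Finset.univ

lemma auxPart_card (k t a : ℕ) (ha : a < 3) : (auxPart k t a).card = k := by
  have hb : (a + 1) * k ≤ 3 * k := Nat.mul_le_mul_right _ (by omega)
  have he : (a + 1) * k = a * k + k := by ring
  have : auxPart k t a = (Finset.univ : Finset (Fin k)).image
      (fun i => Sum.inl (⟨a * k + i.val, by omega⟩ : Fin (3 * k + 1))) := by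
    ext z
    simp only [auxPart, Finset.mem_filter, Finset.mem_univ, true_and, Finset.mem_image]
    constructor
    · rintro ⟨v, rfl, h1, h2⟩
      exact ⟨⟨v.val - a * k, by omega⟩, by congr 1; ext; simp; omega⟩
    · rintro ⟨i, rfl⟩
      exact ⟨_, rfl, by simp, by simp only [he]; omega⟩
  rw [this, Finset.card_image_of_injective]
  · simp
  · intro i j h
    simpa [Fin.ext_iff] using h

lemma auxCore_card (k t : ℕ) : (auxCore k t).card = t + 1 := by
  simp [auxCore, add_comm]

lemma aux_edges (k t : ℕ) :
    (∃ e ∈ suspend 1 (expTriangle k),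
      auxPart k t 0 ∪ auxPart k t 1 ∪ auxCore k t = e.disjSum Finset.univ) ∧
    (∃ e ∈ suspend 1 (expTriangle k),
      auxPart k t 1 ∪ auxPart k t 2 ∪ auxCore k t = e.disjSum Finset.univ) ∧
    (∃ e ∈ suspend 1 (expTriangle k),
      auxPart k t 2 ∪ auxPart k t 0 ∪ auxCore k t = e.disjSum Finset.univ) := by
  have main : ∀ a b : ℕ, a < 3 → b < 3 →
      auxPart k t a ∪ auxPart k t b ∪ auxCore k t =
      (((Finset.univ.filter fun v : Fin (3 * k) => a * k ≤ v.val ∧ v.val < (a + 1) * k) ∪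
        (Finset.univ.filter fun v : Fin (3 * k) => b * k ≤ v.val ∧ v.val < (b + 1) * k)).image
        (Fin.castAdd 1) ∪ Finset.univ.filter fun v : Fin (3 * k + 1) => 3 * k ≤ v.val).disjSum
        Finset.univ := by
    intro a b ha hb
    have hb' : (b + 1) * k ≤ 3 * k := Nat.mul_le_mul_right _ (by omega)
    have ha' : (a + 1) * k ≤ 3 * k := Nat.mul_le_mul_right _ (by omega)
    ext z
    rcases z with z | z
    · simp only [auxPart, auxCore, Finset.mem_union, Finset.mem_filter, Finset.mem_univ, true_and,
        Finset.inl_mem_disjSum, Finset.mem_singleton, Finset.mem_image, Sum.inl.injEq,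
        exists_eq_left']
      constructor
      · rintro ((h | h) | h)
        · exact Or.inl ⟨⟨z.val, by omega⟩, Or.inl h, rfl⟩
        · exact Or.inl ⟨⟨z.val, by omega⟩, Or.inr h, rfl⟩
        · exact Or.inr (by rw [h]; simp)
      · rintro (⟨v, h, hv⟩ | h)
        · left
          rw [← hv]
          simpa using h
        · right
          ext
          simp only [Fin.val_last]
          omega
    · simp [auxPart, auxCore]
  refine ⟨⟨_, ?_, main 0 1 (by omega) (by omega)⟩, ⟨_, ?_, main 1 2 (by omega) (by omega)⟩,
    ⟨_, ?_, main 2 0 (by omega) (by omega)⟩⟩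
  all_goals
    apply Finset.mem_image_of_mem
    simp [expTriangle]

lemma aux_three (r : ℕ) (hr : 3 ≤ r) (hodd : Odd r) {m : ℕ} (F : Finset (Finset (Fin m)))
    (hF : ∀ e ∈ F, e.card = r) (h3 : F.card = 3) :
    ∃ k, 1 ≤ k ∧ k ≤ r / 2 ∧ ∃ ψ : Fin m → Fin (3 * k + 1) ⊕ Fin (r - (2 * k + 1)),
      ∀ e ∈ F, ∃ e' ∈ suspend 1 (expTriangle k), e.image ψ = e'.disjSum Finset.univ := by
  obtain ⟨A, B, C, -, -, -, rfl⟩ := Finset.card_eq_three.1 h3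
  have hA : A.card = r := hF A (by simp)
  have hB : B.card = r := hF B (by simp)
  have hC : C.card = r := hF C (by simp)
  obtain ⟨f, cA, cB, cC, s1, s2, s3⟩ := aux_merge r _ A B C rfl hA hB hC
  obtain ⟨k, k0, k1, k2, k3⟩ := aux_cards r _ _ _ cA cB cC s1 s2 s3
  obtain ⟨q, hq⟩ := hodd
  rcases Nat.eq_zero_or_pos k with hk | hk
  · subst hk
    -- all three edges have merged into one
    have e1 : A.image f ∩ B.image f ∩ C.image f = A.image f :=
      Finset.eq_of_subset_of_card_le (fun x hx => by
        simp only [Finset.mem_inter] at hx; exact hx.1.1) (by omega)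
    have e2 : A.image f ∩ B.image f ∩ C.image f = B.image f :=
      Finset.eq_of_subset_of_card_le (fun x hx => by
        simp only [Finset.mem_inter] at hx; exact hx.1.2) (by omega)
    have e3 : A.image f ∩ B.image f ∩ C.image f = C.image f :=
      Finset.eq_of_subset_of_card_le (fun x hx => by
        simp only [Finset.mem_inter] at hx; exact hx.2) (by omega)
    obtain ⟨⟨e, he, hee⟩, -, -⟩ := aux_edges 1 (r - (2 * 1 + 1))
    have hc : (A.image f).card = (e.disjSum (Finset.univ : Finset (Fin (r - (2 * 1 + 1))))).card := by
      have hd : Disjoint (auxPart 1 (r - (2 * 1 + 1)) 0) (auxPart 1 (r - (2 * 1 + 1)) 1) := by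
        rw [Finset.disjoint_left]
        intro z h0 h1
        simp only [auxPart, Finset.mem_filter, Finset.mem_univ, true_and] at h0 h1
        obtain ⟨v, rfl, _, _⟩ := h0
        obtain ⟨w, hw, _, _⟩ := h1
        have := Sum.inl.inj hw
        subst this
        omega
      have hd' : Disjoint (auxPart 1 (r - (2 * 1 + 1)) 0 ∪ auxPart 1 (r - (2 * 1 + 1)) 1)
          (auxCore 1 (r - (2 * 1 + 1))) := by
        rw [Finset.disjoint_left]
        intro z h0 h1
        simp only [auxPart, Finset.mem_filter, Finset.mem_univ, true_and, Finset.mem_union] at h0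
        rcases h0 with ⟨v, rfl, _, _⟩ | ⟨v, rfl, _, _⟩ <;>
        · simp only [auxCore, Finset.inl_mem_disjSum, Finset.mem_singleton] at h1
          have h5 := congrArg Fin.val h1
          simp only [Fin.val_last] at h5
          omega
      rw [← hee, Finset.card_union_of_disjoint hd', Finset.card_union_of_disjoint hd,
        auxPart_card _ _ _ (by omega), auxPart_card _ _ _ (by omega), auxCore_card]
      omega
    obtain ⟨g, hg⟩ := aux_exists_image _ _ hc
    refine ⟨1, le_refl _, by omega, g ∘ f, ?_⟩
    intro x hx
    refine ⟨e, he, ?_⟩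
    rw [← Finset.image_image, ← hg]
    simp only [Finset.mem_insert, Finset.mem_singleton] at hx
    rcases hx with rfl | rfl | rfl
    · rfl
    · rw [← e1, e2]
    · rw [← e1, e3]
  · obtain ⟨g, gA, gB, gC⟩ := aux_pieces (A.image f) (B.image f) (C.image f)
      (auxCore k (r - (2 * k + 1))) (auxPart k (r - (2 * k + 1)) 1)
      (auxPart k (r - (2 * k + 1)) 2) (auxPart k (r - (2 * k + 1)) 0) s1 s2 s3
      (by rw [auxCore_card]; omega) (by rw [k1, auxPart_card _ _ _ (by omega)])
      (by rw [k2, auxPart_card _ _ _ (by omega)]) (by rw [k3, auxPart_card _ _ _ (by omega)])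
    obtain ⟨hE1, hE2, hE3⟩ := aux_edges k (r - (2 * k + 1))
    refine ⟨k, hk, by omega, g ∘ f, ?_⟩
    intro x hx
    rw [← Finset.image_image]
    simp only [Finset.mem_insert, Finset.mem_singleton] at hx
    rcases hx with rfl | rfl | rfl
    · rw [gA]; exact hE1
    · rw [gB]; exact hE2
    · rw [gC]; exact hE3

/-- For every odd `r ≥ 3`, `γ(r)` is at most the maximum of
`π(T̂_{2i}^{2i+1})` over `1 ≤ i ≤ ⌊r/2⌋`. -/
theorem gammaT_le_max_susp_odd (r : ℕ) (hr : 3 ≤ r) (hodd : Odd r) :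
    gammaT r ≤ (Finset.Icc 1 (r / 2)).sup' (Finset.nonempty_Icc.mpr (by omega))
      (fun i => turanDensity (2 * i + 1) (suspend 1 (expTriangle i))) := by
  apply Real.sSup_le
  · rintro x ⟨m, F, hF, h3, rfl⟩
    obtain ⟨k, hk1, hk2, ψ, hψ⟩ := aux_three r hr hodd F hF h3
    have hs : 2 * k + 1 + (r - (2 * k + 1)) = r := by
      obtain ⟨q, hq⟩ := hodd
      omega
    have h := aux_dens_le (2 * k + 1) (r - (2 * k + 1)) F (suspend 1 (expTriangle k))
      (fun e he => by rw [hF e he, hs]) ψ hψ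
    rw [hs] at h
    exact h.trans (Finset.le_sup' (fun i => turanDensity (2 * i + 1) (suspend 1 (expTriangle i)))
      (Finset.mem_Icc.2 ⟨hk1, hk2⟩))
  · exact (aux_nonneg _ _).trans
      (Finset.le_sup' (fun i => turanDensity (2 * i + 1) (suspend 1 (expTriangle i)))
        (Finset.mem_Icc.2 ⟨le_refl 1, by omega⟩))
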